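/- Let ζ: ℝ → ℝ be smooth, even, compactly supported, with ζ(0) = 1. Then there is a constant C such that for all ξ ≥ 1, | p.v. ∫ ζ(y) e^{iξy} dy/y − iπ | ≤ C/ξ. In other words, the Fourier transform of the principal-value kernel ζ(y)/y equals iπ + O(|ξ|^{−1}) as ξ → +∞. -/

import Mathlib

open MeasureTheory Filter Set

theorem fourier_indicator_Ioc_mul_self {a : ℝ} (ha : 0 ≤ a) (y : ℝ) :
    FourierTransform.fourier ((Ioc (-a) a).indicator (fun _ => (1 : ℂ))) y * (Real.pi * y) =
      Complex.sin (2 * Real.pi * a * y) := by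
  rcases eq_or_ne y 0 with rfl | hy
  · simp
  have hc : -(2 * Real.pi * y * Complex.I) ≠ 0 := by
    simp [hy, Real.pi_ne_zero]
  have hint : FourierTransform.fourier ((Ioc (-a) a).indicator (fun _ => (1 : ℂ))) y =
      ∫ v in (-a)..a, Complex.exp (-(2 * Real.pi * y * Complex.I) * v) := by
    rw [Real.fourier_real_eq_integral_exp_smul, intervalIntegral.integral_of_le (by linarith),
      ← integral_indicator measurableSet_Ioc]
    congr 1 with v
    by_cases hv : v ∈ Ioc (-a) a
    · simp only [hv, indicator_of_mem, smul_eq_mul, mul_one]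
      congr 1
      push_cast
      ring
    · simp [hv]
  rw [hint, integral_exp_mul_complex hc, Complex.sin]
  have hneg : -(2 * Real.pi * y * Complex.I) * a = -(2 * Real.pi * a * y) * Complex.I := by ring
  have hpos : -(2 * Real.pi * y * Complex.I) * (-a : ℝ) = (2 * Real.pi * a * y) * Complex.I := by
    push_cast
    ring
  rw [hneg, hpos, div_mul_eq_mul_div, div_eq_iff hc]
  linear_combination (Real.pi * y * (Complex.exp (-(2 * Real.pi * a * y) * Complex.I) -
    Complex.exp (2 * Real.pi * a * y * Complex.I))) * Complex.I_sq

theorem integral_mul_sin_div_eq (f : ℝ → ℂ) (hf : Integrable f) {a : ℝ} (ha : 0 ≤ a) :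
    ∫ y : ℝ, f y * Complex.sin (2 * Real.pi * a * y) / y =
      Real.pi * ∫ w in Ioc (-a) a, FourierTransform.fourier f w := by
  have hind : Integrable ((Ioc (-a) a).indicator (fun _ => (1 : ℂ))) :=
    (integrable_indicator_iff measurableSet_Ioc).2 (integrableOn_const (by simp))
  have key := VectorFourier.integral_fourierIntegral_smul_eq_flip (L := innerₗ ℝ)
    (μ := volume) (ν := volume) Real.continuous_fourierChar continuous_inner hf hind
  have hflip : (innerₗ ℝ).flip = innerₗ ℝ := flip_innerₗ ℝ
  rw [hflip] at key
  rw [← integral_indicator measurableSet_Ioc, ← integral_const_mul]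
  have hpi : (Real.pi : ℂ) ≠ 0 := by exact_mod_cast Real.pi_ne_zero
  trans ∫ y : ℝ, Real.pi * (f y • FourierTransform.fourier
    ((Ioc (-a) a).indicator (fun _ => (1 : ℂ))) y)
  · refine integral_congr_ae ?_
    filter_upwards [volume.ae_ne 0] with y hy
    have hy' : (y : ℂ) ≠ 0 := by exact_mod_cast hy
    rw [← fourier_indicator_Ioc_mul_self ha, smul_eq_mul]
    field_simp
  · rw [integral_const_mul, integral_const_mul]
    congr 1
    refine key.symm.trans (integral_congr_ae (.of_forall fun w => ?_))
    by_cases hw : w ∈ Ioc (-a) a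
    · simp [hw]; rfl
    · simp [hw]

theorem norm_integral_sub_integral_Ioc_le (g : ℝ → ℂ) (hg : Integrable g)
    (hg' : Integrable fun w => ‖w‖ * ‖g w‖) {a : ℝ} (ha : 0 < a) :
    ‖(∫ w in Ioc (-a) a, g w) - ∫ w, g w‖ ≤ (∫ w, ‖w‖ * ‖g w‖) / a := by
  rw [← integral_add_compl (measurableSet_Ioc (a := -a) (b := a)) hg, sub_add_cancel_left,
    norm_neg, ← integral_div]
  refine (norm_integral_le_integral_norm _).trans ?_
  refine (setIntegral_mono_on hg.norm.integrableOn (hg'.div_const a).integrableOn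
    measurableSet_Ioc.compl fun w hw => ?_).trans
    (setIntegral_le_integral (hg'.div_const a) (.of_forall fun w => by positivity))
  have : a ≤ ‖w‖ := by
    by_contra! h
    rw [Real.norm_eq_abs, abs_lt] at h
    exact hw ⟨h.1, h.2.le⟩
  rw [le_div_iff₀ ha, mul_comm]
  gcongr

theorem integrable_mul_sin_div {f : ℝ → ℂ} (hf : Integrable f) (ξ : ℝ) :
    Integrable fun y : ℝ => f y * Complex.sin (ξ * y) / y := by
  have hbound (y : ℝ) : ‖Complex.sin (ξ * y) / y‖ ≤ |ξ| := by
    rw [← Complex.ofReal_mul, ← Complex.ofReal_sin, ← Complex.ofReal_div, Complex.norm_real,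
      Real.norm_eq_abs, abs_div]
    refine div_le_of_le_mul₀ (abs_nonneg _) (abs_nonneg _) ?_
    rw [← abs_mul]
    exact Real.abs_sin_le_abs
  simp_rw [mul_div_assoc]
  exact hf.mul_bdd (c := |ξ|) (Measurable.aestronglyMeasurable (by fun_prop)) (.of_forall hbound)

/-- For an even function, only the sine part of the truncated oscillatory integral survives. -/
theorem setIntegral_mul_exp_div_eq {f : ℝ → ℂ} (hf : Integrable f) (heven : ∀ y, f (-y) = f y)
    (ξ : ℝ) {ε : ℝ} (hε : 0 < ε) :
    ∫ y in {y : ℝ | ε < |y|}, f y * Complex.exp (Complex.I * ξ * y) / (y : ℂ) =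
      Complex.I * ∫ y in {y : ℝ | ε < |y|}, f y * Complex.sin (ξ * y) / y := by
  have hS : MeasurableSet {y : ℝ | ε < |y|} := measurableSet_lt measurable_const (by fun_prop)
  have hodd : ∫ y in {y : ℝ | ε < |y|}, f y * Complex.cos (ξ * y) / y = 0 := by
    rw [← integral_indicator hS]
    have h := integral_neg_eq_self
      ({y : ℝ | ε < |y|}.indicator fun y => f y * Complex.cos (ξ * y) / y) volume
    have h' : (fun y : ℝ => {y : ℝ | ε < |y|}.indicator
        (fun y => f y * Complex.cos (ξ * y) / y) (-y)) =
        fun y => -{y : ℝ | ε < |y|}.indicator (fun y => f y * Complex.cos (ξ * y) / y) y := by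
      ext y
      by_cases hy : ε < |y| <;> simp [heven, div_neg, hy]
    rw [h', integral_neg] at h
    exact self_eq_neg.1 h.symm
  have hcos : IntegrableOn (fun y : ℝ => f y * Complex.cos (ξ * y) / y) {y : ℝ | ε < |y|} := by
    simp_rw [mul_div_assoc]
    refine hf.integrableOn.mul_bdd (c := 1 / ε)
      (Measurable.aestronglyMeasurable (by fun_prop)) ?_
    filter_upwards [ae_restrict_mem hS] with y hy
    rw [← Complex.ofReal_mul, ← Complex.ofReal_cos, ← Complex.ofReal_div, Complex.norm_real,
      Real.norm_eq_abs, abs_div]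
    have : ε < |y| := hy
    gcongr
    exact Real.abs_cos_le_one _
  have hsin := (integrable_mul_sin_div hf ξ).integrableOn (s := {y : ℝ | ε < |y|})
  calc
    _ = ∫ y in {y : ℝ | ε < |y|}, (f y * Complex.cos (ξ * y) / y +
          Complex.I * (f y * Complex.sin (ξ * y) / y)) := by
        refine integral_congr_ae (.of_forall fun y => ?_)
        simp only
        rw [mul_assoc, mul_comm Complex.I, Complex.exp_mul_I]
        ring
    _ = _ := by
        rw [integral_add hcos (hsin.const_mul _), hodd, zero_add, integral_const_mul]

theorem tendsto_setIntegral_lt_abs {k : ℝ → ℂ} (hk : Integrable k) :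
    Tendsto (fun ε : ℝ => ∫ y in {y : ℝ | ε < |y|}, k y) (nhdsWithin 0 (Ioi 0))
      (nhds (∫ y, k y)) := by
  have hS (ε : ℝ) : MeasurableSet {y : ℝ | ε < |y|} :=
    measurableSet_lt measurable_const (by fun_prop)
  simp_rw [fun ε => (integral_indicator (f := k) (μ := volume) (hS ε)).symm]
  refine tendsto_integral_filter_of_dominated_convergence (fun y => ‖k y‖)
    (.of_forall fun ε => hk.aestronglyMeasurable.indicator (hS ε))
    (.of_forall fun ε => .of_forall fun y => norm_indicator_le_norm_self _ _) hk.norm ?_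
  filter_upwards [volume.ae_ne 0] with y hy
  refine tendsto_const_nhds.congr' ?_
  filter_upwards [nhdsWithin_le_nhds (Iio_mem_nhds (abs_pos.2 hy))] with ε hε
  exact (indicator_of_mem (s := {y : ℝ | ε < |y|}) hε k).symm

/-- **(2.7)**: for smooth, even, compactly supported `ζ` with `ζ(0) = 1`, the principal value
integral `p.v. ∫ ζ(y) e^{iξy} dy/y` exists and equals `iπ + O(ξ⁻¹)` as `ξ → +∞`. -/
theorem hatKH_asymptotically_i_pi
    (ζ : ℝ → ℝ) (hζsmooth : ContDiff ℝ (⊤ : ℕ∞) ζ) (hζcompact : HasCompactSupport ζ)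
    (hζeven : ∀ y : ℝ, ζ (-y) = ζ y) (hζ0 : ζ 0 = 1) :
    ∃ C : ℝ, ∀ ξ : ℝ, 1 ≤ ξ → ∃ L : ℂ,
      Tendsto
        (fun ε : ℝ =>
          ∫ y in {y : ℝ | ε < |y|}, (ζ y : ℂ) * Complex.exp (Complex.I * ξ * y) / (y : ℂ))
        (nhdsWithin 0 (Set.Ioi 0)) (nhds L) ∧
      ‖L - (Real.pi : ℂ) * Complex.I‖ ≤ C / ξ := by
  have hcompact : HasCompactSupport fun y => (ζ y : ℂ) :=
    hζcompact.comp_left (g := Complex.ofReal) rfl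
  let f : SchwartzMap ℝ ℂ :=
    hcompact.toSchwartzMap (Complex.ofRealCLM.contDiff.comp hζsmooth)
  have hf : Integrable fun y => (ζ y : ℂ) := f.integrable
  let g : SchwartzMap ℝ ℂ := FourierTransform.fourier f
  have hg1 : ∫ w, g w = 1 := by
    have h := congrArg (fun h : SchwartzMap ℝ ℂ => h 0)
      (FourierTransform.fourierInv_fourier_eq (F := SchwartzMap ℝ ℂ) f)
    simp only [SchwartzMap.fourierInv_coe, Real.fourierInv_eq] at h
    have h0 : f 0 = 1 := by
      change (ζ 0 : ℂ) = 1
      simp [hζ0]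
    simpa [h0] using h
  refine ⟨2 * Real.pi ^ 2 * ∫ w, ‖w‖ * ‖g w‖, fun ξ hξ =>
    ⟨Complex.I * ∫ y : ℝ, (ζ y : ℂ) * Complex.sin (ξ * y) / y, ?_, ?_⟩⟩
  · refine ((tendsto_setIntegral_lt_abs (integrable_mul_sin_div hf ξ)).const_mul
      Complex.I).congr' ?_
    filter_upwards [self_mem_nhdsWithin] with ε hε
    exact (setIntegral_mul_exp_div_eq hf (by simp [hζeven]) ξ hε).symm
  · have hξ0 : 0 < ξ := by linarith
    have ha : 0 < ξ / (2 * Real.pi) := by positivity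
    have hL : ∫ y : ℝ, (ζ y : ℂ) * Complex.sin (ξ * y) / y =
        Real.pi * ∫ w in Ioc (-(ξ / (2 * Real.pi))) (ξ / (2 * Real.pi)), g w := by
      refine Eq.trans ?_ (integral_mul_sin_div_eq _ hf ha.le)
      have : (2 * Real.pi * (ξ / (2 * Real.pi) : ℝ) : ℂ) = ξ := by
        have := Real.pi_ne_zero
        exact_mod_cast (by field_simp : 2 * Real.pi * (ξ / (2 * Real.pi)) = ξ)
      rw [this]
    have hg := norm_integral_sub_integral_Ioc_le g g.integrable
      (by simpa using g.integrable_pow_mul volume 1) ha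
    rw [hg1] at hg
    rw [hL, show ∀ z : ℂ, Complex.I * (Real.pi * z) - Real.pi * Complex.I =
      Complex.I * Real.pi * (z - 1) from fun z => by ring, norm_mul, norm_mul, Complex.norm_I,
      one_mul, Complex.norm_real, Real.norm_of_nonneg Real.pi_pos.le]
    refine (mul_le_mul_of_nonneg_left hg Real.pi_pos.le).trans_eq ?_
    field_simp
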